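/- Let G be a group and let μ ∈ G be an element whose normal closure is all of G (i.e., G is generated by the conjugates of μ). Then an element g ∈ G lies in the commutator subgroup G′ of G if and only if there exist a natural number s, elements ξ₁, …, ξ_s ∈ G and integers ε₁, …, ε_s with ε₁ + ⋯ + ε_s = 0 such that g = (ξ₁ μ^{ε₁} ξ₁⁻¹)(ξ₂ μ^{ε₂} ξ₂⁻¹)⋯(ξ_s μ^{ε_s} ξ_s⁻¹). -/

import Mathlib

/-- `g` is a product of conjugates of powers of `μ` with total exponent `k`. -/
def ConjProd {G : Type*} [Group G] (μ g : G) (k : ℤ) : Prop :=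
  ∃ L : List (G × ℤ), (L.map Prod.snd).sum = k ∧
    g = (L.map (fun p => p.1 * μ ^ p.2 * p.1⁻¹)).prod

theorem ConjProd.mul {G : Type*} [Group G] {μ a b : G} {k l : ℤ}
    (ha : ConjProd μ a k) (hb : ConjProd μ b l) : ConjProd μ (a * b) (k + l) := by
  obtain ⟨L, rfl, rfl⟩ := ha
  obtain ⟨M, rfl, rfl⟩ := hb
  exact ⟨L ++ M, by simp, by simp⟩

theorem ConjProd.one {G : Type*} [Group G] (μ : G) : ConjProd μ 1 0 := ⟨[], by simp, by simp⟩

theorem ConjProd.inv {G : Type*} [Group G] {μ a : G} {k : ℤ}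
    (ha : ConjProd μ a k) : ConjProd μ a⁻¹ (-k) := by
  obtain ⟨L, rfl, rfl⟩ := ha
  induction L with
  | nil => simpa using ConjProd.one μ
  | cons p L ih =>
    have h : ConjProd μ (p.1 * μ ^ p.2 * p.1⁻¹)⁻¹ (-p.2) :=
      ⟨[(p.1, -p.2)], by simp, by simp [mul_assoc]⟩
    have := ih.mul h
    simpa only [List.map_cons, List.prod_cons, List.sum_cons, mul_inv_rev (p.1 * μ ^ p.2 * p.1⁻¹),
      neg_add_rev] using this

theorem ConjProd.exists_of_top {G : Type*} [Group G] {μ : G}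
    (hμ : Subgroup.normalClosure ({μ} : Set G) = ⊤) (g : G) : ∃ k, ConjProd μ g k := by
  have hg : g ∈ Subgroup.closure (Group.conjugatesOfSet ({μ} : Set G)) := by
    change g ∈ Subgroup.normalClosure ({μ} : Set G)
    rw [hμ]; trivial
  induction hg using Subgroup.closure_induction with
  | mem x hx =>
    obtain ⟨y, hy, hc⟩ := Group.mem_conjugatesOfSet_iff.1 hx
    obtain rfl := Set.mem_singleton_iff.1 hy
    obtain ⟨c, rfl⟩ := isConj_iff.1 hc
    exact ⟨1, [(c, 1)], by simp, by simp⟩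
  | one => exact ⟨0, ConjProd.one μ⟩
  | mul x y _ _ hx hy =>
    obtain ⟨k, hk⟩ := hx
    obtain ⟨l, hl⟩ := hy
    exact ⟨_, hk.mul hl⟩
  | inv x _ hx =>
    obtain ⟨k, hk⟩ := hx
    exact ⟨_, hk.inv⟩

/-- Johnson–Livingston claim (used in Lemma 5.4): if `G` is normally generated by `μ`,
then `g ∈ G'` iff `g` is a product of conjugates of powers of `μ`
with total exponent sum zero. -/
theorem commutator_mem_iff_prod_conj_zpow (G : Type*) [Group G] (μ : G)
    (hμ : Subgroup.normalClosure ({μ} : Set G) = ⊤) (g : G) :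
    g ∈ commutator G ↔
      ∃ (s : ℕ) (ξ : Fin s → G) (ε : Fin s → ℤ),
        (∑ i, ε i) = 0 ∧
        g = (List.ofFn (fun i => ξ i * μ ^ ε i * (ξ i)⁻¹)).prod := by
  constructor
  · intro hg
    have key : ConjProd μ g 0 := by
      rw [commutator_eq_closure] at hg
      induction hg using Subgroup.closure_induction with
      | mem x hx =>
        obtain ⟨a, b, rfl⟩ := hx
        obtain ⟨k, hk⟩ := ConjProd.exists_of_top hμ a
        obtain ⟨l, hl⟩ := ConjProd.exists_of_top hμ b
        have := ((hk.mul hl).mul hk.inv).mul hl.inv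
        rw [commutatorElement_def]
        convert this using 1
        ring
      | one => exact ConjProd.one μ
      | mul x y _ _ hx hy => simpa using hx.mul hy
      | inv x _ hx => simpa using hx.inv
    obtain ⟨L, h0, rfl⟩ := key
    refine ⟨L.length, fun i => (L.get i).1, fun i => (L.get i).2, ?_, ?_⟩
    · rw [← h0, ← List.sum_ofFn]
      congr 1
      conv_rhs => rw [← List.ofFn_get L, List.map_ofFn]
      rfl
    · congr 1
      conv_lhs => rw [← List.ofFn_get L, List.map_ofFn]
      rfl
  · rintro ⟨s, ξ, ε, h0, rfl⟩
    rw [← Abelianization.ker_of, MonoidHom.mem_ker, map_list_prod, List.map_ofFn, List.prod_ofFn]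
    have : ∀ i, (Abelianization.of ∘ fun i => ξ i * μ ^ ε i * (ξ i)⁻¹) i
        = (Abelianization.of μ) ^ ε i := by
      intro i
      simp [mul_comm]
    simp only [this]
    have h2 : ∀ t : Finset (Fin s), ∏ i ∈ t, (Abelianization.of μ) ^ ε i
        = (Abelianization.of μ) ^ (∑ i ∈ t, ε i) := by
      intro t
      induction t using Finset.induction_on with
      | empty => simp
      | insert a t ha ih => rw [Finset.prod_insert ha, Finset.sum_insert ha, ih, zpow_add]
    rw [h2, h0, zpow_zero]
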